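/- arXiv:2506.05329 — 9 statements merged into one kernel-verified Lean document; each statement's English description precedes it below -/
import Mathlib

section
/- Under the Gaussian experiment setup, the probability of misidentification under uniform allocation satisfies: the sequence n ↦ −(1/(K·n)) · ln P_n( { x : ∃ j ≠ I*, m_{n,j}(x) ≥ m_{n,I*}(x) } ) converges, as n → ∞, to Δ_min(θ)² / (4·K·σ²). -/
open MeasureTheory ProbabilityTheory Filter

lemma aux_sum_law (n : ℕ) (m : ℝ) (v : NNReal) :
    (Measure.pi (fun _ : Fin n => gaussianReal m v)).map (fun x => ∑ l, x l)
      = gaussianReal (n * m) (n * v) := by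
  have hind : iIndepFun (fun (i : Fin n) (x : Fin n → ℝ) => x i)
      (Measure.pi (fun _ : Fin n => gaussianReal m v)) :=
    iIndepFun_pi (X := fun _ x => x) (fun i => aemeasurable_id)
  have key : ∀ s : Finset (Fin n),
      (Measure.pi (fun _ : Fin n => gaussianReal m v)).map (∑ l ∈ s, fun x => x l)
      = gaussianReal (s.card * m) (s.card * v) := by
    intro s
    induction s using Finset.induction_on with
    | empty =>
      simp [gaussianReal_zero_var]
      have : (0 : (Fin n → ℝ) → ℝ) = fun _ => 0 := rfl
      rw [this, Measure.map_const]
      simp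
    | insert a s ha ih =>
      rw [Finset.sum_insert ha, add_comm]
      have h1 := hind.indepFun_finsetSum_of_notMem (fun i => measurable_pi_apply i) ha
      rw [gaussianReal_add_gaussianReal_of_indepFun h1 ih
        (measurePreserving_eval (fun _ : Fin n => gaussianReal m v) a).map_eq]
      rw [Finset.card_insert_of_notMem ha]
      push_cast
      congr 1 <;> ring
  have := key Finset.univ
  simp only [Finset.card_univ, Fintype.card_fin] at this
  rw [← this]
  congr 1
  ext x; simp

lemma aux_diff_law (K n : ℕ) (θ : Fin K → ℝ) (v : NNReal) (i j : Fin K) (hij : j ≠ i) :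
    (Measure.pi (fun i : Fin K => Measure.pi (fun _ : Fin n => gaussianReal (θ i) v))).map
      (fun x => ∑ l, x j l - ∑ l, x i l)
      = gaussianReal (-(n * (θ i - θ j))) (2 * n * v) := by
  have hind : iIndepFun (fun (i : Fin K) (x : Fin K → Fin n → ℝ) => ∑ l, x i l)
      (Measure.pi (fun i : Fin K => Measure.pi (fun _ : Fin n => gaussianReal (θ i) v))) :=
    iIndepFun_pi (X := fun _ (x : Fin n → ℝ) => ∑ l, x l)
      (fun i => Measurable.aemeasurable (by fun_prop))
  have hl : ∀ k, (Measure.pi (fun i : Fin K => Measure.pi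
      (fun _ : Fin n => gaussianReal (θ i) v))).map (fun x => ∑ l, x k l)
      = gaussianReal (n * θ k) (n * v) := by
    intro k
    rw [← aux_sum_law, ← (measurePreserving_eval (fun i : Fin K => Measure.pi
      (fun _ : Fin n => gaussianReal (θ i) v)) k).map_eq, Measure.map_map (by fun_prop) (by fun_prop)]
    rfl
  have h2 := (hind.indepFun hij).comp measurable_id measurable_neg
  have hneg : (Measure.pi (fun i : Fin K => Measure.pi
      (fun _ : Fin n => gaussianReal (θ i) v))).map (Neg.neg ∘ fun x => ∑ l, x i l)
      = gaussianReal (-(n * θ i)) (n * v) := by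
    rw [← Measure.map_map (by fun_prop) (by fun_prop), hl]
    exact gaussianReal_map_neg
  have h3 := gaussianReal_add_gaussianReal_of_indepFun h2 (hl j) hneg
  have e : (fun x : Fin K → Fin n → ℝ => ∑ l, x j l - ∑ l, x i l)
     = (id ∘ fun x => ∑ l, x j l) + (Neg.neg ∘ fun x => ∑ l, x i l) := by
    ext x; simp [sub_eq_add_neg]
  rw [e, h3]
  congr 1 <;> ring

lemma aux_upper (d : ℝ) (hd : 0 ≤ d) (v : NNReal) (hv : v ≠ 0) :
    (gaussianReal (-d) v).real (Set.Ici 0) ≤ Real.exp (-(d ^ 2 / (2 * v))) := by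
  have hv' : (0 : ℝ) < v := by positivity
  have h := measure_ge_le_exp_mul_mgf (μ := gaussianReal (-d) v) (X := id) (t := d / v) 0
    (by positivity) (integrable_exp_mul_gaussianReal _)
  rw [mgf_id_gaussianReal] at h
  refine h.trans (le_of_eq ?_)
  simp only [mul_zero, Real.exp_zero, one_mul]
  congr 1
  field_simp
  ring

lemma aux_lower (d : ℝ) (hd : 0 ≤ d) (v : NNReal) (hv : v ≠ 0) :
    (Real.sqrt (2 * Real.pi * v))⁻¹ * Real.exp (-((1 + d) ^ 2 / (2 * v))) ≤
      (gaussianReal (-d) v).real (Set.Ici 0) := by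
  have hv' : (0 : ℝ) < v := by positivity
  calc _ = ∫ x in Set.Icc (0 : ℝ) 1, (Real.sqrt (2 * Real.pi * v))⁻¹ *
            Real.exp (-((1 + d) ^ 2 / (2 * v))) := by simp
    _ ≤ ∫ x in Set.Icc (0 : ℝ) 1, gaussianPDFReal (-d) v x := by
      apply setIntegral_mono_on _ (integrable_gaussianPDFReal _ _).integrableOn measurableSet_Icc
      · intro x hx
        rw [gaussianPDFReal, neg_div, sub_neg_eq_add]
        have h0 := hx.1
        have h1 := hx.2
        have : (x + d) ^ 2 / (2 * v) ≤ (1 + d) ^ 2 / (2 * v) := by gcongr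
        exact mul_le_mul_of_nonneg_left (Real.exp_le_exp.mpr (neg_le_neg this)) (by positivity)
      · exact integrableOn_const (by simp)
    _ = (gaussianReal (-d) v).real (Set.Icc 0 1) := by
      rw [measureReal_def, gaussianReal_apply_eq_integral _ hv, ENNReal.toReal_ofReal]
      exact integral_nonneg (fun x => gaussianPDFReal_nonneg _ _ _)
    _ ≤ _ := measureReal_mono Set.Icc_subset_Ici_self

lemma aux_limU (k c e s : ℝ) (hc : 0 < c) :
    Tendsto (fun n : ℕ => (1 / (k * n)) * (Real.log (c * n) / 2 + (1 + n * e) ^ 2 / (s * n)))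
      atTop (nhds (e ^ 2 / (s * k))) := by
  have h1 : Tendsto (fun n : ℕ => (1 : ℝ) / n) atTop (nhds 0) :=
    tendsto_const_div_atTop_nhds_zero_nat 1
  have h2 : Tendsto (fun n : ℕ => Real.log n / (n : ℝ)) atTop (nhds 0) := by
    have := Real.isLittleO_log_id_atTop.tendsto_div_nhds_zero.comp
      (tendsto_natCast_atTop_atTop (R := ℝ))
    exact this
  have h3 := (((h1.const_mul (Real.log c)).add h2).const_mul (1 / (2 * k))).add
    (((h1.add_const e).pow 2).const_mul (1 / (s * k)))
  have e3 : (1 / (2 * k)) * (Real.log c * 0 + 0) + (1 / (s * k)) * (0 + e) ^ 2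
      = e ^ 2 / (s * k) := by ring
  rw [e3] at h3
  refine h3.congr' ?_
  filter_upwards [eventually_gt_atTop 0] with n hn
  have hn' : (0 : ℝ) < n := by exact_mod_cast hn
  rw [Real.log_mul hc.ne' hn'.ne']
  have : (1 : ℝ) / n + e = (1 + n * e) / n := by field_simp
  rw [this]
  by_cases hk : k = 0
  · simp [hk]
  by_cases hs : s = 0
  · simp [hs]; field_simp
  field_simp

theorem stmt_2 (K : ℕ) (hK : 2 ≤ K) (σ : ℝ) (hσ : 0 < σ) (θ : Fin K → ℝ) (Istar : Fin K)
    (hmax : ∀ j, j ≠ Istar → θ j < θ Istar) :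
    Tendsto (fun n : ℕ =>
      -(1 / ((K : ℝ) * n)) * Real.log
        ((Measure.pi (fun i : Fin K => Measure.pi (fun _ : Fin n =>
            gaussianReal (θ i) ⟨σ ^ 2, sq_nonneg σ⟩)))
          {x : Fin K → Fin n → ℝ | ∃ j, j ≠ Istar ∧
            (1 / (n : ℝ)) * ∑ ℓ, x Istar ℓ ≤ (1 / (n : ℝ)) * ∑ ℓ, x j ℓ}).toReal)
      atTop
      (nhds ((θ Istar - ⨆ j : {j : Fin K // j ≠ Istar}, θ j.1) ^ 2 / (4 * K * σ ^ 2))) := by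
  have hKpos : (0 : ℝ) < K := by
    have : 0 < K := by omega
    exact_mod_cast this
  have : Nontrivial (Fin K) := Fin.nontrivial_iff_two_le.mpr hK
  have : Nonempty {j : Fin K // j ≠ Istar} := by
    obtain ⟨j, hj⟩ := exists_ne Istar
    exact ⟨⟨j, hj⟩⟩
  obtain ⟨⟨j0, hj0⟩, hj0e⟩ := exists_eq_ciSup_of_finite
    (f := fun j : {j : Fin K // j ≠ Istar} => θ j.1)
  have hle : ∀ j, j ≠ Istar → θ j ≤ θ j0 := by
    intro j hj
    have := le_ciSup (f := fun j : {j : Fin K // j ≠ Istar} => θ j.1)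
      (Set.finite_range _).bddAbove ⟨j, hj⟩
    rw [← hj0e] at this
    exact this
  rw [← hj0e]
  simp only
  set e : ℝ := θ Istar - θ j0 with he
  have hepos : 0 < e := sub_pos.mpr (hmax j0 hj0)
  set v : NNReal := ⟨σ ^ 2, sq_nonneg σ⟩ with hv
  have hvc : (v : ℝ) = σ ^ 2 := rfl
  have hvne : v ≠ 0 := by
    intro h
    have : (v : ℝ) = 0 := by rw [h]; rfl
    rw [hvc] at this
    exact (pow_pos hσ 2).ne' this
  have hlimU := aux_limU K (4 * Real.pi * σ ^ 2) e (4 * σ ^ 2) (by positivity)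
  have hlimL : Tendsto (fun n : ℕ => e ^ 2 / (4 * K * σ ^ 2) - (Real.log K / K) / (n : ℝ)) atTop
      (nhds (e ^ 2 / (4 * K * σ ^ 2))) := by
    simpa using tendsto_const_nhds.sub (tendsto_const_div_atTop_nhds_zero_nat (Real.log K / K))
  have e4 : e ^ 2 / (4 * σ ^ 2 * K) = e ^ 2 / (4 * K * σ ^ 2) := by ring
  rw [e4] at hlimU
  have main : ∀ n : ℕ, 0 < n →
      (Real.sqrt (4 * Real.pi * σ ^ 2 * n))⁻¹ * Real.exp (-((1 + n * e) ^ 2 / (4 * σ ^ 2 * n))) ≤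
      ((Measure.pi (fun i : Fin K => Measure.pi (fun _ : Fin n => gaussianReal (θ i) v)))
          {x : Fin K → Fin n → ℝ | ∃ j, j ≠ Istar ∧
            (1 / (n : ℝ)) * ∑ ℓ, x Istar ℓ ≤ (1 / (n : ℝ)) * ∑ ℓ, x j ℓ}).toReal ∧
      ((Measure.pi (fun i : Fin K => Measure.pi (fun _ : Fin n => gaussianReal (θ i) v)))
          {x : Fin K → Fin n → ℝ | ∃ j, j ≠ Istar ∧
            (1 / (n : ℝ)) * ∑ ℓ, x Istar ℓ ≤ (1 / (n : ℝ)) * ∑ ℓ, x j ℓ}).toReal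
        ≤ K * Real.exp (-(n * e ^ 2 / (4 * σ ^ 2))) := by
    intro n hn
    have hn' : (0 : ℝ) < n := by exact_mod_cast hn
    have hwne : (2 * n * v : NNReal) ≠ 0 := by
      have : (n : NNReal) ≠ 0 := by exact_mod_cast hn.ne'
      positivity
    have hwc : ((2 * n * v : NNReal) : ℝ) = 2 * n * σ ^ 2 := by push_cast; rw [hvc]
    set P := Measure.pi (fun i : Fin K => Measure.pi (fun _ : Fin n => gaussianReal (θ i) v))
      with hP
    have hev : ∀ j, j ≠ Istar → P.real {x : Fin K → Fin n → ℝ |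
        (1 / (n : ℝ)) * ∑ ℓ, x Istar ℓ ≤ (1 / (n : ℝ)) * ∑ ℓ, x j ℓ} =
        (gaussianReal (-(n * (θ Istar - θ j))) (2 * n * v)).real (Set.Ici 0) := by
      intro j hj
      rw [← aux_diff_law K n θ v Istar j hj,
        map_measureReal_apply (by fun_prop) measurableSet_Ici]
      congr 1
      ext x
      simp only [Set.mem_ofPred_eq, Set.mem_preimage, Set.mem_Ici, sub_nonneg]
      exact mul_le_mul_iff_right₀ (by positivity)
    rw [← measureReal_def]
    constructor
    · have h1 := aux_lower (n * e) (by positivity) (2 * n * v) hwne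
      rw [he, ← hev j0 hj0, hwc] at h1
      rw [he]
      refine le_trans (le_of_eq ?_) (h1.trans (measureReal_mono ?_))
      · ring_nf
      · intro x hx
        exact ⟨j0, hj0, hx⟩
    · have hsub : {x : Fin K → Fin n → ℝ | ∃ j, j ≠ Istar ∧
            (1 / (n : ℝ)) * ∑ ℓ, x Istar ℓ ≤ (1 / (n : ℝ)) * ∑ ℓ, x j ℓ} ⊆
          ⋃ j ∈ Finset.univ.erase Istar, {x : Fin K → Fin n → ℝ |
            (1 / (n : ℝ)) * ∑ ℓ, x Istar ℓ ≤ (1 / (n : ℝ)) * ∑ ℓ, x j ℓ} := by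
        rintro x ⟨j, hj, hx⟩
        simp only [Set.mem_iUnion]
        exact ⟨j, by simp [hj], hx⟩
      refine (measureReal_mono hsub (measure_ne_top P _)).trans ((measureReal_biUnion_finset_le _ _).trans ?_)
      have hb : ∀ j ∈ Finset.univ.erase Istar, P.real {x : Fin K → Fin n → ℝ |
            (1 / (n : ℝ)) * ∑ ℓ, x Istar ℓ ≤ (1 / (n : ℝ)) * ∑ ℓ, x j ℓ} ≤
            Real.exp (-(n * e ^ 2 / (4 * σ ^ 2))) := by
        intro j hj
        have hj' := Finset.ne_of_mem_erase hj
        have hge : e ≤ θ Istar - θ j := by have := hle j hj'; linarith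
        rw [hev j hj']
        refine (aux_upper _ (mul_nonneg hn'.le (hepos.le.trans hge)) _ hwne).trans ?_
        rw [hwc, Real.exp_le_exp, neg_le_neg_iff]
        calc n * e ^ 2 / (4 * σ ^ 2) = (n * e) ^ 2 / (2 * (2 * n * σ ^ 2)) := by field_simp; ring
          _ ≤ _ := by gcongr
      refine (Finset.sum_le_card_nsmul _ _ _ hb).trans ?_
      rw [nsmul_eq_mul]
      gcongr
      exact (Finset.card_le_univ _).trans (by simp)
  refine tendsto_of_tendsto_of_tendsto_of_le_of_le' hlimL hlimU ?_ ?_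
  · filter_upwards [eventually_gt_atTop 0] with n hn
    have hn' : (0 : ℝ) < n := by exact_mod_cast hn
    obtain ⟨h1, h2⟩ := main n hn
    have hpos := lt_of_lt_of_le (by positivity) h1
    have h3 := Real.log_le_log hpos h2
    rw [Real.log_mul hKpos.ne' (Real.exp_pos _).ne', Real.log_exp] at h3
    rw [neg_mul, le_neg]
    refine (mul_le_mul_of_nonneg_left h3 (by positivity)).trans (le_of_eq ?_)
    field_simp
    ring
  · filter_upwards [eventually_gt_atTop 0] with n hn
    have hn' : (0 : ℝ) < n := by exact_mod_cast hn
    obtain ⟨h1, h2⟩ := main n hn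
    have h3 := Real.log_le_log (by positivity) h1
    rw [Real.log_mul (by positivity) (Real.exp_pos _).ne', Real.log_exp, Real.log_inv,
      Real.log_sqrt (by positivity)] at h3
    rw [neg_mul, neg_le, ← mul_neg]
    refine mul_le_mul_of_nonneg_left (le_trans (le_of_eq ?_) h3) (by positivity)
    ring
end

section
/- For every n ∈ {2,…,K}, one has Γ_{θ,n} ≥ ((n−1)/n) · Δ_min(θ)² / (2σ²). -/
/-- `Γ_{θ,n}`: the minimum, over subsets `J` of cardinality `n` containing the best arm `Istar`,
of the infimum over `λ` with `λ_{Istar} ≤ λ_i` for all `i ∈ J` of `Σ_{i∈J} (λ_i − θ_i)²/(2σ²)`. -/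
noncomputable def Gamma (K : ℕ) (σ : ℝ) (θ : Fin K → ℝ) (Istar : Fin K) (n : ℕ) : ℝ :=
  sInf { v : ℝ | ∃ J : Finset (Fin K), J.card = n ∧ Istar ∈ J ∧
    v = sInf { u : ℝ | ∃ lam : Fin K → ℝ, (∀ i ∈ J, lam Istar ≤ lam i) ∧
      u = ∑ i ∈ J, (lam i - θ i) ^ 2 / (2 * σ ^ 2) } }

/-- `Γ_{θ,n} ≥ ((n−1)/n)·Δ_min(θ)²/(2σ²)` for every `n ∈ {2,…,K}`. -/
theorem stmt_4 (K : ℕ) (hK : 2 ≤ K) (σ : ℝ) (hσ : 0 < σ) (θ : Fin K → ℝ) (Istar : Fin K)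
    (hmax : ∀ j, j ≠ Istar → θ j < θ Istar)
    (n : ℕ) (hn2 : 2 ≤ n) (hnK : n ≤ K) :
    Gamma K σ θ Istar n ≥
      (((n : ℝ) - 1) / n) * (θ Istar - ⨆ j : {j : Fin K // j ≠ Istar}, θ j.1) ^ 2
        / (2 * σ ^ 2) := by
  set S := ⨆ j : {j : Fin K // j ≠ Istar}, θ j.1 with hS
  have hle : ∀ j, j ≠ Istar → θ j ≤ S := fun j hj =>
    le_ciSup (f := fun j : {j : Fin K // j ≠ Istar} => θ j.1)
      (Set.finite_range _).bddAbove ⟨j, hj⟩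
  have hSle : S ≤ θ Istar := by
    haveI : Nontrivial (Fin K) := Fin.nontrivial_iff_two_le.mpr hK
    obtain ⟨j, hj⟩ := exists_ne Istar
    haveI : Nonempty {j : Fin K // j ≠ Istar} := ⟨⟨j, hj⟩⟩
    exact ciSup_le fun j => (hmax j.1 j.2).le
  have hn0 : (0 : ℝ) < n := by
    have : 0 < n := by omega
    exact_mod_cast this
  unfold Gamma
  apply le_csInf
  · obtain ⟨J, hJ1, -, hJ2⟩ := Finset.exists_subsuperset_card_eq
      (Finset.subset_univ ({Istar} : Finset (Fin K))) (n := n) (by simp; omega) (by simpa using hnK)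
    exact ⟨_, J, hJ2, hJ1 (Finset.mem_singleton_self _), rfl⟩
  rintro v ⟨J, hJc, hJ, rfl⟩
  apply le_csInf
  · exact ⟨_, fun _ => 0, fun _ _ => le_rfl, rfl⟩
  rintro u ⟨lam, hlam, rfl⟩
  rw [← Finset.sum_div]
  apply div_le_div_of_nonneg_right _ (by positivity)
  rw [← Finset.add_sum_erase J _ hJ]
  set D := θ Istar - S with hD
  have hD0 : 0 ≤ D := by linarith
  set c := D / n with hc
  have hc0 : 0 ≤ c := by positivity
  have hDc : D = n * c := by rw [hc]; field_simp
  have hcard : (((J.erase Istar).card : ℕ) : ℝ) = (n : ℝ) - 1 := by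
    rw [Finset.card_erase_of_mem hJ, hJc, Nat.cast_sub (by omega)]; simp
  have hsum : ((n : ℝ) - 1) * (2 * c * (lam Istar - S) - c ^ 2) ≤
      ∑ i ∈ J.erase Istar, (lam i - θ i) ^ 2 := by
    rw [← hcard, ← nsmul_eq_mul]
    apply Finset.card_nsmul_le_sum
    intro i hi
    have h1 := hlam i (Finset.mem_of_mem_erase hi)
    have h2 := hle i (Finset.ne_of_mem_erase hi)
    have h3 : c * (lam Istar - S) ≤ c * (lam i - θ i) :=
      mul_le_mul_of_nonneg_left (by linarith) hc0
    nlinarith [sq_nonneg (lam i - θ i - c)]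
  have hSe : S = θ Istar - n * c := by linarith
  have hl : ((n : ℝ) - 1) / n * D ^ 2 = (n - 1) * n * c ^ 2 := by
    rw [hDc]; field_simp
  rw [hl]
  rw [hSe] at hsum
  nlinarith [sq_nonneg (lam Istar - θ Istar + (n - 1) * c)]
end

section
/- Suppose in addition that all suboptimal arms are equal, i.e. θ_i = θ_j for all i, j ≠ I*. Then for every n ∈ {2,…,K}, Γ_{θ,n} = ((n−1)/n) · Δ_min(θ)² / (2σ²). -/
theorem inner_val (K : ℕ) (σ : ℝ) (hσ : 0 < σ) (θ : Fin K → ℝ) (Istar : Fin K) (c : ℝ)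
    (hc : ∀ j, j ≠ Istar → θ j = c) (hac : c ≤ θ Istar)
    (J : Finset (Fin K)) (hI : Istar ∈ J) (n : ℕ) (hn : J.card = n) (hn1 : 1 ≤ n) :
    sInf { u : ℝ | ∃ lam : Fin K → ℝ, (∀ i ∈ J, lam Istar ≤ lam i) ∧
      u = ∑ i ∈ J, (lam i - θ i) ^ 2 / (2 * σ ^ 2) } =
      (((n : ℝ) - 1) / n) * (θ Istar - c) ^ 2 / (2 * σ ^ 2) := by
  have hnpos : (0 : ℝ) < n := by exact_mod_cast hn1
  have hcard : ((J.erase Istar).card : ℝ) = (n : ℝ) - 1 := by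
    rw [Finset.card_erase_of_mem hI, hn, Nat.cast_sub hn1]; simp
  apply IsLeast.csInf_eq
  constructor
  · refine ⟨fun _ => c + (θ Istar - c) / n, fun _ _ => le_rfl, ?_⟩
    rw [← Finset.sum_div, ← Finset.add_sum_erase _ _ hI]
    congr 1
    have : ∀ i ∈ J.erase Istar, (c + (θ Istar - c) / n - θ i) ^ 2 = ((θ Istar - c) / n) ^ 2 := by
      intro i hi
      rw [hc i (Finset.ne_of_mem_erase hi)]; ring
    rw [Finset.sum_congr rfl this, Finset.sum_const, nsmul_eq_mul, hcard]
    field_simp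
    ring
  · rintro u ⟨lam, hl, rfl⟩
    rw [← Finset.sum_div, ← Finset.add_sum_erase _ _ hI]
    apply div_le_div_of_nonneg_right _ (by positivity)
    obtain ⟨t, ht⟩ : ∃ t, t = (θ Istar - c) / n := ⟨_, rfl⟩
    have ht0 : 0 ≤ t := ht ▸ div_nonneg (by linarith) hnpos.le
    have hD : θ Istar = c + n * t := by rw [ht]; field_simp; ring
    have h1 : ∀ i ∈ J.erase Istar, 2 * t * (lam Istar - c) - t ^ 2 ≤ (lam i - θ i) ^ 2 := by
      intro i hi
      rw [hc i (Finset.ne_of_mem_erase hi)]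
      have := hl i (Finset.mem_of_mem_erase hi)
      nlinarith [sq_nonneg (lam i - c - t), mul_nonneg ht0 (sub_nonneg.2 this)]
    have h2 := Finset.card_nsmul_le_sum _ _ _ h1
    rw [nsmul_eq_mul, hcard] at h2
    have h3 : ((n : ℝ) - 1) / n * (θ Istar - c) ^ 2 = (n - 1) * n * t ^ 2 := by
      rw [hD]; field_simp; ring
    rw [h3]
    refine le_trans ?_ (add_le_add le_rfl h2)
    rw [hD]
    nlinarith [sq_nonneg (lam Istar - c - t)]

/-- If all suboptimal arms are equal, then `Γ_{θ,n} = ((n−1)/n)·Δ_min(θ)²/(2σ²)`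
for every `n ∈ {2,…,K}`. -/
theorem stmt_5 (K : ℕ) (hK : 2 ≤ K) (σ : ℝ) (hσ : 0 < σ) (θ : Fin K → ℝ) (Istar : Fin K)
    (hmax : ∀ j, j ≠ Istar → θ j < θ Istar)
    (heq : ∀ i j, i ≠ Istar → j ≠ Istar → θ i = θ j)
    (n : ℕ) (hn2 : 2 ≤ n) (hnK : n ≤ K) :
    Gamma K σ θ Istar n =
      (((n : ℝ) - 1) / n) * (θ Istar - ⨆ j : {j : Fin K // j ≠ Istar}, θ j.1) ^ 2
        / (2 * σ ^ 2) := by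
  have : Nontrivial (Fin K) := Fin.nontrivial_iff_two_le.2 hK
  obtain ⟨j0, hj0⟩ := exists_ne Istar
  have hne : Nonempty {j : Fin K // j ≠ Istar} := ⟨⟨j0, hj0⟩⟩
  have hsup : (⨆ j : {j : Fin K // j ≠ Istar}, θ j.1) = θ j0 := by
    have : (fun j : {j : Fin K // j ≠ Istar} => θ j.1) = fun _ => θ j0 :=
      funext fun j => heq _ _ j.2 hj0
    rw [this, ciSup_const]
  rw [hsup]
  have key := fun J hI hn => inner_val K σ hσ θ Istar (θ j0) (fun j hj => heq _ _ hj hj0)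
    (hmax j0 hj0).le J hI n hn (by omega)
  obtain ⟨J0, hJ1, -, hJ2⟩ := Finset.exists_subsuperset_card_eq
    (Finset.subset_univ ({Istar} : Finset (Fin K))) (n := n) (by simp; omega) (by simpa using hnK)
  have hI0 : Istar ∈ J0 := hJ1 (by simp)
  unfold Gamma
  apply IsLeast.csInf_eq
  constructor
  · exact ⟨J0, hJ2, hI0, (key J0 hI0 hJ2).symm⟩
  · rintro v ⟨J, hJ, hI, rfl⟩
    exact (key J hI hJ).ge
end

section
/- For any batch weights, the large-deviation rate of batched arm elimination satisfies min_{n∈{2,…,K}} w_n · Γ_{θ,n} ≥ (Δ_min(θ)²/(2σ²)) · min_{n∈{2,…,K}} w_n · (n−1)/n. -/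
/-- `w_n = Σ_{m=n}^K β_m / m`. -/
noncomputable def w (K : ℕ) (β : ℕ → ℝ) (n : ℕ) : ℝ :=
  ∑ m ∈ Finset.Icc n K, β m / m

lemma cost_lower (K : ℕ) (σ : ℝ) (hσ : 0 < σ) (θ : Fin K → ℝ) (Istar : Fin K)
    (D : ℝ) (hD : 0 ≤ D) (hgap : ∀ j, j ≠ Istar → θ j + D ≤ θ Istar)
    (n : ℕ) (hn : 2 ≤ n) (J : Finset (Fin K)) (hJ : J.card = n) (hI : Istar ∈ J)
    (lam : Fin K → ℝ) (hl : ∀ i ∈ J, lam Istar ≤ lam i) :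
    D ^ 2 / (2 * σ ^ 2) * (((n : ℝ) - 1) / n) ≤ ∑ i ∈ J, (lam i - θ i) ^ 2 / (2 * σ ^ 2) := by
  have hn' : (2 : ℝ) ≤ n := by exact_mod_cast hn
  have key : D ^ 2 * (((n : ℝ) - 1) / n) ≤ ∑ i ∈ J, (lam i - θ i) ^ 2 := by
    rw [← Finset.add_sum_erase J _ hI]
    have hcard : ((J.erase Istar).card : ℝ) = (n : ℝ) - 1 := by
      rw [Finset.card_erase_of_mem hI, hJ, Nat.cast_sub (by omega)]
      simp
    rw [← mul_div_assoc, div_le_iff₀ (by linarith)]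
    rcases le_total D (θ Istar - lam Istar) with h | h
    · have h1 : 0 ≤ ∑ i ∈ J.erase Istar, (lam i - θ i) ^ 2 :=
        Finset.sum_nonneg fun i _ => sq_nonneg _
      have h2 : D ^ 2 ≤ (lam Istar - θ Istar) ^ 2 := by nlinarith
      have h3 : D ^ 2 * n ≤ ((lam Istar - θ Istar) ^ 2 +
          ∑ i ∈ J.erase Istar, (lam i - θ i) ^ 2) * n :=
        mul_le_mul_of_nonneg_right (by linarith) (by linarith)
      nlinarith [sq_nonneg D]
    · have h1 : ((n : ℝ) - 1) * (D - (θ Istar - lam Istar)) ^ 2 ≤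
          ∑ i ∈ J.erase Istar, (lam i - θ i) ^ 2 := by
        rw [← hcard, ← nsmul_eq_mul]
        apply Finset.card_nsmul_le_sum
        intro i hi
        have h4 := hgap i (Finset.ne_of_mem_erase hi)
        have h5 := hl i (Finset.mem_of_mem_erase hi)
        apply pow_le_pow_left₀ <;> linarith
      have h3 := mul_le_mul_of_nonneg_right
        (add_le_add_right h1 ((lam Istar - θ Istar) ^ 2)) (by linarith : (0 : ℝ) ≤ n)
      refine le_trans ?_ h3
      nlinarith [sq_nonneg ((n : ℝ) * (θ Istar - lam Istar) - (n - 1) * D)]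
  rw [← Finset.sum_div, div_mul_eq_mul_div]
  exact div_le_div_of_nonneg_right key (by positivity)

lemma Gamma_lower (K : ℕ) (σ : ℝ) (hσ : 0 < σ) (θ : Fin K → ℝ) (Istar : Fin K)
    (D : ℝ) (hD : 0 ≤ D) (hgap : ∀ j, j ≠ Istar → θ j + D ≤ θ Istar)
    (n : ℕ) (hn : 2 ≤ n) (hnK : n ≤ K) :
    D ^ 2 / (2 * σ ^ 2) * (((n : ℝ) - 1) / n) ≤ Gamma K σ θ Istar n := by
  unfold Gamma
  apply le_csInf
  · obtain ⟨J, h1, -, h2⟩ := Finset.exists_subsuperset_card_eq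
      (Finset.subset_univ ({Istar} : Finset (Fin K))) (n := n)
      (by simp; omega) (by simpa using hnK)
    exact ⟨_, J, h2, h1 (by simp), rfl⟩
  · rintro v ⟨J, hJ, hI, rfl⟩
    apply le_csInf
    · exact ⟨_, fun _ => 0, fun _ _ => le_rfl, rfl⟩
    · rintro u ⟨lam, hl, rfl⟩
      exact cost_lower K σ hσ θ Istar D hD hgap n hn J hJ hI lam hl

/-- For any batch weights,
`min_{n∈{2,…,K}} w_n·Γ_{θ,n} ≥ (Δ_min(θ)²/(2σ²)) · min_{n∈{2,…,K}} w_n·(n−1)/n`. -/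
theorem stmt_6 (K : ℕ) (hK : 2 ≤ K) (σ : ℝ) (hσ : 0 < σ) (θ : Fin K → ℝ) (Istar : Fin K)
    (hmax : ∀ j, j ≠ Istar → θ j < θ Istar)
    (β : ℕ → ℝ) (hβ : ∀ m ∈ Finset.Icc 2 K, 0 ≤ β m)
    (hsum : ∑ m ∈ Finset.Icc 2 K, β m = 1) :
    (Finset.Icc 2 K).inf' (Finset.nonempty_Icc.mpr hK)
        (fun n => w K β n * Gamma K σ θ Istar n)
      ≥ ((θ Istar - ⨆ j : {j : Fin K // j ≠ Istar}, θ j.1) ^ 2 / (2 * σ ^ 2)) *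
        (Finset.Icc 2 K).inf' (Finset.nonempty_Icc.mpr hK)
          (fun n => w K β n * (((n : ℝ) - 1) / n)) := by
  have hne : Nonempty {j : Fin K // j ≠ Istar} := by
    haveI : Nontrivial (Fin K) := Fin.nontrivial_iff_two_le.mpr hK
    obtain ⟨j, hj⟩ := exists_ne Istar
    exact ⟨⟨j, hj⟩⟩
  have hle : ∀ j, j ≠ Istar → θ j ≤ ⨆ j : {j : Fin K // j ≠ Istar}, θ j.1 := fun j hj =>
    le_ciSup (f := fun j : {j : Fin K // j ≠ Istar} => θ j.1)
      (Set.finite_range _).bddAbove ⟨j, hj⟩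
  have hsup : (⨆ j : {j : Fin K // j ≠ Istar}, θ j.1) ≤ θ Istar :=
    ciSup_le fun j => (hmax j.1 j.2).le
  apply Finset.le_inf'
  intro n hn
  have hn2 := Finset.mem_Icc.mp hn
  have hG := Gamma_lower K σ hσ θ Istar (θ Istar - ⨆ j : {j : Fin K // j ≠ Istar}, θ j.1)
    (by linarith) (fun j hj => by linarith [hle j hj]) n hn2.1 hn2.2
  have hw : 0 ≤ w K β n := by
    unfold w
    apply Finset.sum_nonneg
    intro m hm
    have hm2 := Finset.mem_Icc.mp hm
    exact div_nonneg (hβ m (Finset.mem_Icc.mpr ⟨by omega, hm2.2⟩)) (Nat.cast_nonneg m)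
  have h1 := Finset.inf'_le (fun n : ℕ => w K β n * (((n : ℝ) - 1) / n)) hn
  refine le_trans (mul_le_mul_of_nonneg_left h1 (by positivity)) ?_
  have h2 := mul_le_mul_of_nonneg_left hG hw
  refine le_trans (le_of_eq ?_) h2
  ring
end

section
/- Let K ≥ 3 be an integer, let s ∈ {1,…,K−2}, and let β_K ∈ [0,1) with the two-batch weights β_{K−s} = 1 − β_K and β_m = 0 for all other m ∈ {2,…,K−1}. Then min_{n∈{2,…,K}} w_n·(n−1)/n > 1/(2K) holds if and only if β_K > 1/2 + 1/(2(K−s)). -/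
theorem w_two_batch (k s : ℕ) (hs : 1 ≤ s) (b : ℝ) (n : ℕ) (hn : n ≤ k + s) :
    w (k + s) (fun m => if m = k + s then b else if m = k + s - s then 1 - b else 0) n
      = b / ((k : ℝ) + s) + if n ≤ k then (1 - b) / k else 0 := by
  have h : ∀ m : ℕ, (if m = k + s then b else if m = k + s - s then 1 - b else 0) / (m : ℝ)
      = (if m = k + s then b / ((k : ℝ) + s) else 0) + (if m = k then (1 - b) / (k : ℝ) else 0) := by
    intro m
    rw [Nat.add_sub_cancel]
    by_cases h1 : m = k + s
    · have h2 : m ≠ k := by omega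
      rw [if_pos h1, if_pos h1, if_neg h2, h1]
      push_cast
      ring
    · by_cases h2 : m = k
      · rw [if_neg h1, if_neg h1, if_pos h2, if_pos h2, h2]
        ring
      · simp [h1, h2]
  unfold w
  simp only [h]
  rw [Finset.sum_add_distrib, Finset.sum_ite_eq', Finset.sum_ite_eq']
  have h3 : k + s ∈ Finset.Icc n (k + s) := by simp [hn]
  rw [if_pos h3]
  simp

/-- For the two-batch design that eliminates `s` arms after a first batch of
fraction `β_K` (so `β_{K−s} = 1 − β_K` and all other weights vanish), the CRT-dominance
condition `min_{n∈{2,…,K}} w_n·(n−1)/n > 1/(2K)` holds if and only if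
`β_K > 1/2 + 1/(2(K−s))`. -/
theorem stmt_8 (K : ℕ) (hK : 3 ≤ K) (s : ℕ) (hs1 : 1 ≤ s) (hs2 : s ≤ K - 2)
    (bK : ℝ) (hb0 : 0 ≤ bK) (hb1 : bK < 1) :
    (Finset.Icc 2 K).inf' (Finset.nonempty_Icc.mpr (by omega))
        (fun n => w K (fun m => if m = K then bK else if m = K - s then 1 - bK else 0) n
          * (((n : ℝ) - 1) / n))
      > 1 / (2 * K)
    ↔ bK > 1 / 2 + 1 / (2 * ((K : ℝ) - s)) := by
  obtain ⟨k, rfl⟩ : ∃ k, K = k + s := ⟨K - s, by omega⟩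
  have hk : 2 ≤ k := by omega
  have hkR : (2 : ℝ) ≤ k := by exact_mod_cast hk
  have hsR : (1 : ℝ) ≤ s := by exact_mod_cast hs1
  rw [gt_iff_lt, Finset.lt_inf'_iff]
  push_cast
  have hsub : (k : ℝ) + s - s = k := by ring
  rw [hsub]
  have key : 1 / 2 + 1 / (2 * (k : ℝ)) = (k + 1) / (2 * k) := by field_simp
  rw [key, gt_iff_lt, div_lt_iff₀ (by positivity)]
  constructor
  · intro h
    have h1 := h (k + 1) (by simp; omega)
    rw [w_two_batch k s hs1 bK (k + 1) (by omega), if_neg (by omega)] at h1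
    push_cast at h1
    rw [add_zero, div_mul_div_comm, div_lt_div_iff₀ (by positivity) (by positivity)] at h1
    have h2 : 0 < (k : ℝ) + s := by positivity
    have h3 : ((k : ℝ) + s) * (k + 1) < ((k : ℝ) + s) * (bK * (2 * k)) := by linarith
    exact lt_of_mul_lt_mul_left h3 h2.le
  · intro h n hn
    rw [Finset.mem_Icc] at hn
    rw [w_two_batch k s hs1 bK n hn.2]
    have hnR : (2 : ℝ) ≤ n := by exact_mod_cast hn.1
    have h2 : 0 < (k : ℝ) + s := by positivity
    split_ifs with hc
    · have e1 : (1 - bK) / ((k : ℝ) + s) < (1 - bK) / k :=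
        div_lt_div_of_pos_left (by linarith) (by linarith) (by linarith)
      have e2 : 1 / ((k : ℝ) + s) < bK / ((k : ℝ) + s) + (1 - bK) / k := by
        have : 1 / ((k : ℝ) + s) = bK / ((k : ℝ) + s) + (1 - bK) / ((k : ℝ) + s) := by ring
        linarith
      have e3 : (1 : ℝ) / 2 ≤ ((n : ℝ) - 1) / n := by
        rw [div_le_div_iff₀ (by norm_num) (by linarith)]
        linarith
      have e4 : 1 / (2 * ((k : ℝ) + s)) = 1 / ((k : ℝ) + s) * (1 / 2) := by
        field_simp
      rw [e4]
      exact mul_lt_mul e2 e3 (by norm_num) (le_trans (by positivity) e2.le)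
    · have hcR : (k : ℝ) + 1 ≤ n := by
        have : k + 1 ≤ n := by omega
        exact_mod_cast this
      rw [add_zero, div_mul_div_comm, div_lt_div_iff₀ (by positivity) (by positivity)]
      have e5 : (n : ℝ) < 2 * bK * (n - 1) := by
        have hb : 1 / 2 < bK := by nlinarith
        nlinarith
      nlinarith
end

section
/- Let n ≥ 2, let μ₁ > μ₂ ≥ ⋯ ≥ μₙ, write Δ_i = μ₁ − μ_i, and let m ∈ {1,…,n−1}. Suppose Δ_{n−j} > (Σ_{i=n−j+1}^n Δ_i)/(j+1) for every j ∈ {1,…,m−1}, and Δ_{n−m} ≤ (Σ_{i=n−m+1}^n Δ_i)/(m+1). Then Ψ(μ₁,…,μₙ) = (Σ_{i=n−m+1}^n Δ_i²) − (Σ_{i=n−m+1}^n Δ_i)²/(m+1). -/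
/-- `Ψ(μ₁,…,μₙ)`: the infimum of `Σ_{i=1}^n (λ_i − μ_i)²` over `λ ∈ ℝⁿ` with
`λ₁ ≤ λ_i` for every `i ∈ {1,…,n}` (1-based indexing). -/
noncomputable def Psi (n : ℕ) (μ : ℕ → ℝ) : ℝ :=
  sInf { v : ℝ | ∃ lam : ℕ → ℝ, (∀ i ∈ Finset.Icc 1 n, lam 1 ≤ lam i) ∧
    v = ∑ i ∈ Finset.Icc 1 n, (lam i - μ i) ^ 2 }

/-- the closed-form value of `Ψ` under the `m`-th condition of Corollary 2,
with `Δ_i = μ₁ − μ_i`. -/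
theorem stmt_9 (n : ℕ) (hn : 2 ≤ n) (μ : ℕ → ℝ)
    (h12 : μ 2 < μ 1)
    (hmono : ∀ i, 2 ≤ i → i + 1 ≤ n → μ (i + 1) ≤ μ i)
    (m : ℕ) (hm1 : 1 ≤ m) (hm2 : m ≤ n - 1)
    (hcond1 : ∀ j, 1 ≤ j → j < m →
      μ 1 - μ (n - j) > (∑ i ∈ Finset.Icc (n - j + 1) n, (μ 1 - μ i)) / ((j : ℝ) + 1))
    (hcond2 : μ 1 - μ (n - m) ≤ (∑ i ∈ Finset.Icc (n - m + 1) n, (μ 1 - μ i)) / ((m : ℝ) + 1)) :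
    Psi n μ = (∑ i ∈ Finset.Icc (n - m + 1) n, (μ 1 - μ i) ^ 2)
      - (∑ i ∈ Finset.Icc (n - m + 1) n, (μ 1 - μ i)) ^ 2 / ((m : ℝ) + 1) := by
  have hanti : ∀ i j, 2 ≤ i → i ≤ j → j ≤ n → μ j ≤ μ i := by
    intro i j hi hij
    induction j, hij using Nat.le_induction with
    | base => intro _; exact le_refl _
    | succ k hk ih =>
      intro hkn
      exact (hmono k (by omega) hkn).trans (ih (by omega))
  set S := Finset.Icc (n - m + 1) n with hS
  set T := ∑ i ∈ S, (μ 1 - μ i) with hT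
  have hmpos : (0 : ℝ) < (m : ℝ) + 1 := by positivity
  obtain ⟨c, hc⟩ : ∃ c, c = T / ((m : ℝ) + 1) := ⟨_, rfl⟩
  have hTc : T = ((m : ℝ) + 1) * c := by rw [hc]; field_simp
  have hcard : (S.card : ℝ) = m := by
    rw [hS, Nat.card_Icc]; congr 1; omega
  have h1S : 1 ∉ S := by rw [hS, Finset.mem_Icc]; omega
  have hsub : insert 1 S ⊆ Finset.Icc 1 n := by
    intro i hi
    simp only [hS, Finset.mem_insert, Finset.mem_Icc] at hi ⊢
    omega
  -- the smallest gap in S is at least c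
  have hfirst : c ≤ μ 1 - μ (n - m + 1) := by
    rcases Nat.lt_or_ge 1 m with h | h
    · have h1 := hcond1 (m - 1) (by omega) (by omega)
      have e1 : n - (m - 1) = n - m + 1 := by omega
      have e2 : ((m - 1 : ℕ) : ℝ) + 1 = m := by
        rw [Nat.cast_sub hm1]; simp
      rw [e1, e2] at h1
      have hm0 : (0 : ℝ) < m := by exact_mod_cast hm1
      rw [gt_iff_lt, div_lt_iff₀ hm0] at h1
      have hT2 : T = (μ 1 - μ (n - m + 1)) + ∑ i ∈ Finset.Icc (n - m + 1 + 1) n, (μ 1 - μ i) := by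
        rw [hT, hS, ← Finset.insert_Icc_add_one_left_eq_Icc (by omega : n - m + 1 ≤ n),
          Finset.sum_insert (by simp)]
      rw [hc, div_le_iff₀ hmpos]
      linarith
    · have hm : m = 1 := by omega
      subst hm
      have e1 : n - 1 + 1 = n := by omega
      have hT2 : T = μ 1 - μ n := by rw [hT, hS, e1]; simp
      have := hanti 2 n le_rfl hn le_rfl
      rw [e1, hc, hT2]
      norm_num
      linarith
  have hge : ∀ i ∈ S, c ≤ μ 1 - μ i := by
    intro i hi
    rw [hS, Finset.mem_Icc] at hi
    have := hanti (n - m + 1) i (by omega) hi.1 hi.2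
    linarith
  have hval : c ^ 2 + ∑ i ∈ S, (μ 1 - μ i - c) ^ 2
      = (∑ i ∈ S, (μ 1 - μ i) ^ 2) - T ^ 2 / ((m : ℝ) + 1) := by
    have e : ∑ i ∈ S, (μ 1 - μ i - c) ^ 2
        = ∑ i ∈ S, (μ 1 - μ i) ^ 2 - 2 * c * T + m * c ^ 2 := by
      rw [hT, ← hcard, Finset.mul_sum, ← Finset.sum_sub_distrib, ← nsmul_eq_mul,
        ← Finset.sum_const, ← Finset.sum_add_distrib]
      exact Finset.sum_congr rfl fun i _ => by ring
    rw [e, hTc]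
    field_simp
    ring
  rw [← hval]
  unfold Psi
  apply IsLeast.csInf_eq
  constructor
  · refine ⟨fun i => if i ∈ insert 1 S then μ 1 - c else μ i, ?_, ?_⟩
    · intro i hi
      beta_reduce; rw [if_pos (Finset.mem_insert_self 1 S)]
      split_ifs with h
      · exact le_rfl
      · simp only [hS, Finset.mem_insert, Finset.mem_Icc] at h hi
        have := hanti i (n - m) (by omega) (by omega) (by omega)
        rw [← hc] at hcond2
        linarith
    · rw [← Finset.sum_subset hsub, Finset.sum_insert h1S]
      · congr 1
        · beta_reduce; rw [if_pos (Finset.mem_insert_self 1 S)]; ring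
        · refine Finset.sum_congr rfl fun i hi => ?_
          beta_reduce; rw [if_pos (Finset.mem_insert_of_mem hi)]; ring
      · intro i _ hi
        beta_reduce; rw [if_neg hi]; ring
  · rintro v ⟨lam, hlam, rfl⟩
    refine le_trans ?_ (Finset.sum_le_sum_of_subset_of_nonneg hsub fun i _ _ => sq_nonneg _)
    rw [Finset.sum_insert h1S]
    have hpt : ∀ i ∈ S, (μ 1 - μ i - c) ^ 2
        + 2 * (c - (μ 1 - lam 1)) * (μ 1 - μ i - c) ≤ (lam i - μ i) ^ 2 := by
      intro i hi
      have h1 := hge i hi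
      have h2 := hlam i (hsub (Finset.mem_insert_of_mem hi))
      nlinarith [sq_nonneg (lam i - μ i - (μ 1 - μ i - c)),
        mul_nonneg (sub_nonneg.2 h1) (sub_nonneg.2 h2)]
    have hs := Finset.sum_le_sum hpt
    rw [Finset.sum_add_distrib, ← Finset.mul_sum] at hs
    have hd : ∑ i ∈ S, (μ 1 - μ i - c) = c := by
      rw [Finset.sum_sub_distrib, ← hT, Finset.sum_const, nsmul_eq_mul, hcard, hTc]; ring
    rw [hd] at hs
    nlinarith [sq_nonneg (μ 1 - lam 1 - c)]
end

section
/- Let n ≥ 2 and μ₁ > μ₂ ≥ ⋯ ≥ μₙ. Then Ψ(μ₁,…,μₙ) ≥ ((n−1)/n)·(μ₁ − μ₂)². -/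
/-- `Ψ(μ₁,…,μₙ) ≥ ((n−1)/n)·(μ₁ − μ₂)²`. -/
theorem stmt_10 (n : ℕ) (hn : 2 ≤ n) (μ : ℕ → ℝ)
    (h12 : μ 2 < μ 1)
    (hmono : ∀ i, 2 ≤ i → i + 1 ≤ n → μ (i + 1) ≤ μ i) :
    Psi n μ ≥ (((n : ℝ) - 1) / n) * (μ 1 - μ 2) ^ 2 := by
  have hn' : (2:ℝ) ≤ n := by exact_mod_cast hn
  have hn0 : (0:ℝ) < n := by linarith
  have hle : ∀ i, 2 ≤ i → i ≤ n → μ i ≤ μ 2 := by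
    intro i hi
    induction i, hi using Nat.le_induction with
    | base => intro _; exact le_refl _
    | succ k hk ih => intro h; exact (hmono k hk h).trans (ih (by omega))
  unfold Psi
  apply le_csInf
  · exact ⟨_, fun _ => 0, fun _ _ => le_refl _, rfl⟩
  rintro v ⟨lam, hlam, rfl⟩
  have hsplit : ∑ i ∈ Finset.Icc 1 n, (lam i - μ i) ^ 2
      = (lam 1 - μ 1) ^ 2 + ∑ i ∈ Finset.Icc 2 n, (lam i - μ i) ^ 2 := by
    rw [← Finset.add_sum_Ioc_eq_sum_Icc (by omega : 1 ≤ n)]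
    rfl
  rw [hsplit, div_mul_eq_mul_div, div_le_iff₀ hn0]
  by_cases ht : lam 1 ≤ μ 2
  · have h0 : 0 ≤ ∑ i ∈ Finset.Icc 2 n, (lam i - μ i) ^ 2 :=
      Finset.sum_nonneg fun _ _ => sq_nonneg _
    have h1 : (μ 1 - μ 2) ^ 2 ≤ (lam 1 - μ 1) ^ 2 := by nlinarith
    nlinarith [mul_le_mul_of_nonneg_right h1 hn0.le, mul_nonneg h0 hn0.le,
      sq_nonneg (μ 1 - μ 2)]
  · push Not at ht
    have h1 : ((n:ℝ) - 1) * (lam 1 - μ 2) ^ 2 ≤ ∑ i ∈ Finset.Icc 2 n, (lam i - μ i) ^ 2 := by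
      have := Finset.card_nsmul_le_sum (Finset.Icc 2 n) (fun i => (lam i - μ i) ^ 2)
        ((lam 1 - μ 2) ^ 2) (by
          intro i hi
          rw [Finset.mem_Icc] at hi
          have a := hle i hi.1 hi.2
          have b := hlam i (Finset.mem_Icc.2 ⟨by omega, hi.2⟩)
          exact pow_le_pow_left₀ (by linarith) (by linarith) 2)
      rw [Nat.card_Icc, nsmul_eq_mul, Nat.cast_sub (by omega)] at this
      push_cast at this
      linarith
    nlinarith [mul_le_mul_of_nonneg_right h1 hn0.le,
      sq_nonneg ((lam 1 - μ 1) + ((n:ℝ) - 1) * (lam 1 - μ 2))]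
end

section
/- Let n ≥ 2 and μ₁ > μ₂ ≥ ⋯ ≥ μₙ. Then equality Ψ(μ₁,…,μₙ) = ((n−1)/n)·(μ₁ − μ₂)² holds if and only if μ₂ = μ₃ = ⋯ = μₙ. -/
/-- equality `Ψ(μ₁,…,μₙ) = ((n−1)/n)·(μ₁ − μ₂)²` holds iff `μ₂ = ⋯ = μₙ`. -/
theorem stmt_13 (n : ℕ) (hn : 2 ≤ n) (μ : ℕ → ℝ)
    (h12 : μ 2 < μ 1)
    (hmono : ∀ i, 2 ≤ i → i + 1 ≤ n → μ (i + 1) ≤ μ i) :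
    Psi n μ = (((n : ℝ) - 1) / n) * (μ 1 - μ 2) ^ 2 ↔ ∀ i, 2 ≤ i → i ≤ n → μ i = μ 2 := by
  have hn0 : (0 : ℝ) < n := by
    have : 0 < n := by omega
    exact_mod_cast this
  obtain ⟨s, hs⟩ : ∃ s : ℝ, μ 1 - μ 2 = n * s := ⟨(μ 1 - μ 2) / n, by field_simp⟩
  have hspos : 0 < s := by
    have h : 0 < (n : ℝ) * s := by linarith
    exact (pos_iff_pos_of_mul_pos h).mp hn0
  have hc : (((n : ℝ) - 1) / n) * (μ 1 - μ 2) ^ 2 = n * (n - 1) * s ^ 2 := by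
    rw [hs]; field_simp
  have hsplit : ∀ f : ℕ → ℝ, ∑ i ∈ Finset.Icc 1 n, f i = f 1 + ∑ i ∈ Finset.Icc 2 n, f i := by
    intro f
    rw [← Finset.add_sum_Ioc_eq_sum_Icc (by omega : 1 ≤ n)]
    rfl
  have hcard : ((Finset.Icc 2 n).card : ℝ) = n - 1 := by
    rw [Nat.card_Icc, show n + 1 - 2 = n - 1 by omega, Nat.cast_sub (by omega)]
    simp
  have hle : ∀ i, 2 ≤ i → i ≤ n → μ i ≤ μ 2 := by
    intro i hi
    induction i, hi using Nat.le_induction with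
    | base => intro _; exact le_rfl
    | succ k hk ih => intro h; exact (hmono k hk h).trans (ih (by omega))
  have hlow : ∀ v ∈ { v : ℝ | ∃ lam : ℕ → ℝ, (∀ i ∈ Finset.Icc 1 n, lam 1 ≤ lam i) ∧
      v = ∑ i ∈ Finset.Icc 1 n, (lam i - μ i) ^ 2 },
      n * (n - 1) * s ^ 2 + 2 * s * ∑ i ∈ Finset.Icc 2 n, (μ 2 - μ i) ≤ v := by
    rintro v ⟨lam, hlam, rfl⟩
    rw [hsplit]
    have h1 : ∑ i ∈ Finset.Icc 2 n, ((2 * s * (lam 1 - μ 2) - s ^ 2) + 2 * s * (μ 2 - μ i))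
        ≤ ∑ i ∈ Finset.Icc 2 n, (lam i - μ i) ^ 2 := by
      apply Finset.sum_le_sum
      intro i hi
      rw [Finset.mem_Icc] at hi
      have h := hlam i (Finset.mem_Icc.mpr ⟨by omega, hi.2⟩)
      nlinarith [sq_nonneg (lam i - μ i - s), mul_nonneg hspos.le (sub_nonneg.mpr h)]
    rw [Finset.sum_add_distrib, Finset.sum_const, nsmul_eq_mul, hcard, ← Finset.mul_sum] at h1
    have h2 : μ 2 = μ 1 - n * s := by linarith
    have h3 : (n : ℝ) * (n - 1) * s ^ 2 ≤
        (lam 1 - μ 1) ^ 2 + (n - 1) * (2 * s * (lam 1 - μ 2) - s ^ 2) := by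
      rw [h2]
      nlinarith [sq_nonneg (lam 1 - μ 1 + (n - 1) * s)]
    linarith
  have hne : { v : ℝ | ∃ lam : ℕ → ℝ, (∀ i ∈ Finset.Icc 1 n, lam 1 ≤ lam i) ∧
      v = ∑ i ∈ Finset.Icc 1 n, (lam i - μ i) ^ 2 }.Nonempty :=
    ⟨_, fun _ => 0, fun _ _ => le_rfl, rfl⟩
  have hPsi := le_csInf hne hlow
  change _ ≤ Psi n μ at hPsi
  rw [hc]
  constructor
  · intro h i hi hin
    rw [h] at hPsi
    have hS : ∑ i ∈ Finset.Icc 2 n, (μ 2 - μ i) ≤ 0 := by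
      by_contra hcon
      push Not at hcon
      have := mul_pos hspos hcon
      linarith
    have hnn : ∀ j ∈ Finset.Icc 2 n, 0 ≤ μ 2 - μ j := fun j hj => by
      rw [Finset.mem_Icc] at hj
      linarith [hle j hj.1 hj.2]
    have := Finset.single_le_sum hnn (Finset.mem_Icc.mpr ⟨hi, hin⟩)
    linarith [hle i hi hin]
  · intro h
    have hz : ∑ i ∈ Finset.Icc 2 n, (μ 2 - μ i) = 0 := by
      apply Finset.sum_eq_zero
      intro i hi
      rw [Finset.mem_Icc] at hi
      rw [h i hi.1 hi.2, sub_self]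
    rw [hz, mul_zero, add_zero] at hPsi
    refine le_antisymm ?_ hPsi
    refine csInf_le ⟨_, hlow⟩ ⟨fun _ => μ 2 + s, fun _ _ => le_rfl, ?_⟩
    rw [hsplit]
    have h4 : ∑ i ∈ Finset.Icc 2 n, (μ 2 + s - μ i) ^ 2 = ∑ i ∈ Finset.Icc 2 n, s ^ 2 := by
      apply Finset.sum_congr rfl
      intro i hi
      rw [Finset.mem_Icc] at hi
      rw [h i hi.1 hi.2]; ring
    rw [h4, Finset.sum_const, nsmul_eq_mul, hcard]
    have h5 : μ 1 = μ 2 + n * s := by linarith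
    rw [h5]; ring
end

section
/- Under the Gaussian experiment setup, let J ⊆ {1,…,K} be a subset containing I*, and define Γ_J = inf over λ ∈ ℝ^K with λ_{I*} ≤ λ_i for all i ∈ J of Σ_{i∈J} (λ_i − θ_i)²/(2σ²). Then for every n ≥ 1, the probability that the best arm's empirical mean is smallest within J under equal allocation satisfies the non-asymptotic large-deviation bound P_n( { x : ∀ i ∈ J, m_{n,I*}(x) ≤ m_{n,i}(x) } ) ≤ exp(−n·Γ_J). -/
open MeasureTheory ProbabilityTheory

lemma aux_mgf (K n : ℕ) (θ c : Fin K → ℝ) (v : NNReal) :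
    Integrable (fun x : Fin K → Fin n → ℝ => Real.exp (1 * ∑ i, c i * ∑ ℓ, x i ℓ))
      (Measure.pi (fun i : Fin K => Measure.pi (fun _ : Fin n => gaussianReal (θ i) v))) ∧
    mgf (fun x : Fin K → Fin n → ℝ => ∑ i, c i * ∑ ℓ, x i ℓ)
      (Measure.pi (fun i : Fin K => Measure.pi (fun _ : Fin n => gaussianReal (θ i) v))) 1
      = Real.exp (n * ∑ i, (θ i * c i + v * c i ^ 2 / 2)) := by
  have h : (fun x : Fin K → Fin n → ℝ => Real.exp (1 * ∑ i, c i * ∑ ℓ, x i ℓ)) =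
      fun x => ∏ i, (fun (i : Fin K) (y : Fin n → ℝ) =>
        ∏ ℓ, (fun (_ : Fin n) (z : ℝ) => Real.exp (c i * z)) ℓ (y ℓ)) i (x i) := by
    funext x
    simp only [one_mul, Real.exp_sum, Finset.mul_sum]
  constructor
  · rw [h]
    refine Integrable.fintype_prod (f := (fun (i : Fin K) (y : Fin n → ℝ) =>
        ∏ ℓ, (fun (_ : Fin n) (z : ℝ) => Real.exp (c i * z)) ℓ (y ℓ)))
      (μ := fun i : Fin K => Measure.pi (fun _ : Fin n => gaussianReal (θ i) v)) ?_
    intro i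
    refine Integrable.fintype_prod (f := fun (_ : Fin n) (z : ℝ) => Real.exp (c i * z))
      (μ := fun _ : Fin n => gaussianReal (θ i) v) ?_
    intro ℓ
    exact integrable_exp_mul_gaussianReal (c i)
  · unfold mgf
    rw [h]
    refine (integral_fintype_prod_eq_prod (𝕜 := ℝ) (fun (i : Fin K) (y : Fin n → ℝ) =>
        ∏ ℓ, (fun (_ : Fin n) (z : ℝ) => Real.exp (c i * z)) ℓ (y ℓ))
      (μ := fun i : Fin K => Measure.pi (fun _ : Fin n => gaussianReal (θ i) v))).trans ?_
    have h2 : ∀ i : Fin K, ∫ z, Real.exp (c i * z) ∂(gaussianReal (θ i) v)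
        = Real.exp (θ i * c i + v * c i ^ 2 / 2) := fun i =>
      congrFun (mgf_fun_id_gaussianReal (μ := θ i) (v := v)) (c i)
    have h3 : ∀ i : Fin K, (∫ y : Fin n → ℝ,
        ∏ ℓ, (fun (_ : Fin n) (z : ℝ) => Real.exp (c i * z)) ℓ (y ℓ)
          ∂(Measure.pi (fun _ : Fin n => gaussianReal (θ i) v)))
        = Real.exp (n * (θ i * c i + v * c i ^ 2 / 2)) := by
      intro i
      refine (integral_fintype_prod_eq_prod (𝕜 := ℝ)
        (fun (_ : Fin n) (z : ℝ) => Real.exp (c i * z))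
        (μ := fun _ : Fin n => gaussianReal (θ i) v)).trans ?_
      simp only [h2, Finset.prod_const, Finset.card_univ, Fintype.card_fin]
      rw [← Real.exp_nat_mul]
    rw [Finset.prod_congr rfl (fun i _ => h3 i), ← Real.exp_sum, Finset.mul_sum]

lemma aux_proj (K : ℕ) (θ : Fin K → ℝ) (I : Fin K) (J : Finset (Fin K)) :
    ∃ p : Fin K → ℝ, (∀ i ∈ J, p I ≤ p i) ∧
      ∀ w : Fin K → ℝ, (∀ i ∈ J, w I ≤ w i) → 0 ≤ ∑ i, (p i - θ i) * (w i - p i) := by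
  let C : Set (EuclideanSpace ℝ (Fin K)) := {w | ∀ i ∈ J, w I ≤ w i}
  have hconv : Convex ℝ C := by
    intro x hx y hy a b ha hb _ i hi
    have h1 := mul_le_mul_of_nonneg_left (hx i hi) ha
    have h2 := mul_le_mul_of_nonneg_left (hy i hi) hb
    simpa using add_le_add h1 h2
  have hcl : IsClosed C := by
    have : C = ⋂ i ∈ J, {w : EuclideanSpace ℝ (Fin K) | w I ≤ w i} := by
      ext w; simp [C]
    rw [this]
    exact isClosed_biInter fun i _ => isClosed_le (by fun_prop) (by fun_prop)
  obtain ⟨p, hp, hmin⟩ := exists_norm_eq_iInf_of_complete_convex (K := C)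
    ⟨0, fun i _ => le_rfl⟩ hcl.isComplete hconv (WithLp.toLp 2 θ)
  rw [norm_eq_iInf_iff_real_inner_le_zero hconv hp] at hmin
  refine ⟨fun i => p i, hp, fun w hw => ?_⟩
  have := hmin (WithLp.toLp 2 w) hw
  simp only [PiLp.inner_apply, PiLp.sub_apply, RCLike.inner_apply, conj_trivial] at this
  have e : ∑ i, (p i - θ i) * (w i - p i) = -∑ i, (w i - p i) * (θ i - p i) := by
    rw [← Finset.sum_neg_distrib]
    exact Finset.sum_congr rfl fun i _ => by ring
  rw [e]
  linarith

/-- Under the Gaussian experiment setup with `n` observations per arm, the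
probability that the best arm's empirical mean is smallest within a set `J ∋ I*` is at most
`exp(−n·Γ_J)`, where `Γ_J = inf {Σ_{i∈J} (λ_i − θ_i)²/(2σ²) : λ_{I*} ≤ λ_i ∀ i ∈ J}`. -/
theorem stmt_14 (K : ℕ) (hK : 2 ≤ K) (σ : ℝ) (hσ : 0 < σ) (θ : Fin K → ℝ) (Istar : Fin K)
    (hmax : ∀ j, j ≠ Istar → θ j < θ Istar)
    (J : Finset (Fin K)) (hJ : Istar ∈ J)
    (n : ℕ) (hn : 1 ≤ n) :
    (Measure.pi (fun i : Fin K => Measure.pi (fun _ : Fin n =>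
        gaussianReal (θ i) ⟨σ ^ 2, sq_nonneg σ⟩)))
      {x : Fin K → Fin n → ℝ | ∀ i ∈ J,
        (1 / (n : ℝ)) * ∑ ℓ, x Istar ℓ ≤ (1 / (n : ℝ)) * ∑ ℓ, x i ℓ}
    ≤ ENNReal.ofReal (Real.exp (-(n : ℝ) *
        sInf { u : ℝ | ∃ lam : Fin K → ℝ, (∀ i ∈ J, lam Istar ≤ lam i) ∧
          u = ∑ i ∈ J, (lam i - θ i) ^ 2 / (2 * σ ^ 2) })) := by
  obtain ⟨p, hp, hvar⟩ := aux_proj K θ Istar J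
  set v : NNReal := ⟨σ ^ 2, sq_nonneg σ⟩ with hv
  have hvc : (v : ℝ) = σ ^ 2 := rfl
  have hn0 : (0 : ℝ) < n := by exact_mod_cast hn
  set c : Fin K → ℝ := fun i => (p i - θ i) / σ ^ 2 with hc
  obtain ⟨hint, hmgf⟩ := aux_mgf K n θ c v
  set P := Measure.pi (fun i : Fin K => Measure.pi (fun _ : Fin n => gaussianReal (θ i) v)) with hP
  have hch := measure_ge_le_exp_mul_mgf (μ := P) (n * ∑ i, c i * p i) zero_le_one hint
  rw [hmgf, ← Real.exp_add] at hch
  have hsub : {x : Fin K → Fin n → ℝ | ∀ i ∈ J,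
        (1 / (n : ℝ)) * ∑ ℓ, x Istar ℓ ≤ (1 / (n : ℝ)) * ∑ ℓ, x i ℓ} ⊆
      {x | n * ∑ i, c i * p i ≤ ∑ i, c i * ∑ ℓ, x i ℓ} := by
    intro x hx
    have h := hvar (fun i => (1 / (n : ℝ)) * ∑ ℓ, x i ℓ) hx
    have e : ∑ i, c i * ∑ ℓ, x i ℓ - n * ∑ i, c i * p i =
        (n / σ ^ 2) * ∑ i, (p i - θ i) * ((1 / (n : ℝ)) * ∑ ℓ, x i ℓ - p i) := by
      rw [Finset.mul_sum, Finset.mul_sum, ← Finset.sum_sub_distrib]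
      refine Finset.sum_congr rfl fun i _ => ?_
      simp only [hc]
      field_simp
    have : 0 ≤ (n / σ ^ 2) * ∑ i, (p i - θ i) * ((1 / (n : ℝ)) * ∑ ℓ, x i ℓ - p i) :=
      mul_nonneg (by positivity) h
    show n * ∑ i, c i * p i ≤ ∑ i, c i * ∑ ℓ, x i ℓ
    linarith
  have hG : sInf { u : ℝ | ∃ lam : Fin K → ℝ, (∀ i ∈ J, lam Istar ≤ lam i) ∧
          u = ∑ i ∈ J, (lam i - θ i) ^ 2 / (2 * σ ^ 2) } ≤
      ∑ i, (p i - θ i) ^ 2 / (2 * σ ^ 2) := by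
    refine le_trans (b := ∑ i ∈ J, (p i - θ i) ^ 2 / (2 * σ ^ 2))
      (csInf_le ⟨0, ?_⟩ ⟨p, hp, rfl⟩) ?_
    · rintro u ⟨lam, -, rfl⟩
      exact Finset.sum_nonneg fun i _ => by positivity
    · exact Finset.sum_le_sum_of_subset_of_nonneg (Finset.subset_univ _)
        fun i _ _ => by positivity
  have hexp : -1 * (n * ∑ i, c i * p i) + n * ∑ i, (θ i * c i + v * c i ^ 2 / 2)
      = -(n : ℝ) * ∑ i, (p i - θ i) ^ 2 / (2 * σ ^ 2) := by
    simp only [Finset.mul_sum]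
    rw [← Finset.sum_add_distrib]
    refine Finset.sum_congr rfl fun i _ => ?_
    simp only [hc, hvc]
    field_simp
    ring
  rw [hexp] at hch
  refine (measure_mono hsub).trans ?_
  rw [← ofReal_measureReal]
  refine ENNReal.ofReal_le_ofReal (hch.trans (Real.exp_le_exp.mpr ?_))
  have := mul_le_mul_of_nonneg_left hG hn0.le
  linarith
end
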